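/- arXiv:math/0506316 — 2 statements merged into one kernel-verified Lean document; each statement's English description precedes it below -/
import Mathlib

section
/- Any two triangulated surfaces with exactly 6 vertices and Euler characteristic 1 are combinatorially isomorphic; i.e., the 6-vertex triangulation of the real projective plane is unique up to combinatorial isomorphism. -/
open scoped Classical

/-- A triangulated surface on the vertex set `Fin n`: a finite 2-dimensional simplicial
complex given by its set of triangles, which is connected, in which every vertex lies in
some triangle, every edge lies in exactly two triangles, and the link of every vertex is
a single cycle (encoded as: the link graph of every vertex is connected; together with the
condition that every edge lies in exactly two triangles this makes every vertex link a
single circle). -/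
structure TriSurface (n : ℕ) where
  faces : Finset (Finset (Fin n))
  card_eq : ∀ f ∈ faces, f.card = 3
  vertex_mem : ∀ v : Fin n, ∃ f ∈ faces, v ∈ f
  edge_two : ∀ u v : Fin n, u ≠ v → (∃ f ∈ faces, u ∈ f ∧ v ∈ f) →
      (faces.filter (fun f => u ∈ f ∧ v ∈ f)).card = 2
  conn : ∀ u v : Fin n,
      Relation.ReflTransGen (fun a b : Fin n => ∃ f ∈ faces, a ∈ f ∧ b ∈ f) u v
  link_cycle : ∀ v a b : Fin n,
      (∃ f ∈ faces, v ∈ f ∧ a ∈ f ∧ a ≠ v) →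
      (∃ f ∈ faces, v ∈ f ∧ b ∈ f ∧ b ≠ v) →
      Relation.ReflTransGen
        (fun x y : Fin n => x ≠ y ∧ x ≠ v ∧ y ≠ v ∧ ({v, x, y} : Finset (Fin n)) ∈ faces)
        a b

/-- The edges of a triangulated surface: all 2-element vertex sets contained in a triangle. -/
noncomputable def TriSurface.edges {n : ℕ} (S : TriSurface n) : Finset (Finset (Fin n)) :=
  Finset.univ.filter (fun e => e.card = 2 ∧ ∃ f ∈ S.faces, e ⊆ f)

/-- The Euler characteristic χ = f₀ - f₁ + f₂ of a triangulated surface. -/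
noncomputable def TriSurface.eulerChar {n : ℕ} (S : TriSurface n) : ℤ :=
  (n : ℤ) - (S.edges.card : ℤ) + (S.faces.card : ℤ)

/-- Combinatorial isomorphism: a bijection of the vertices mapping triangles to triangles. -/
def TriSurface.Iso {n : ℕ} (S T : TriSurface n) : Prop :=
  ∃ σ : Equiv.Perm (Fin n), ∀ f : Finset (Fin n), f ∈ S.faces ↔ f.image σ ∈ T.faces

/-- Orientability: each triangle can be given a cyclic orientation (recorded as the set of
its three induced directed edges) such that the two orientations induced on each edge by
the two triangles containing it are opposite (no directed edge is induced twice). -/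
def TriSurface.Orientable {n : ℕ} (S : TriSurface n) : Prop :=
  ∃ ω : Finset (Fin n) → Finset (Fin n × Fin n),
    (∀ f ∈ S.faces, ∃ a b c : Fin n, a ≠ b ∧ a ≠ c ∧ b ≠ c ∧
        f = {a, b, c} ∧ ω f = {(a, b), (b, c), (c, a)}) ∧
    (∀ f ∈ S.faces, ∀ g ∈ S.faces, f ≠ g → ∀ p ∈ ω f, p ∉ ω g)

/-- The edge `uv` is contractible: the only common neighbours of `u` and `v` are the two
vertices `w`, `z` with `uvw`, `uvz` triangles, and the edge `wz` is not contained in both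
the link of `u` and the link of `v`. -/
def TriSurface.Contractible {n : ℕ} (S : TriSurface n) (u v : Fin n) : Prop :=
  ({u, v} : Finset (Fin n)) ∈ S.edges ∧
  (∀ w : Fin n, w ≠ u → w ≠ v →
      ({u, w} : Finset (Fin n)) ∈ S.edges → ({v, w} : Finset (Fin n)) ∈ S.edges →
      ({u, v, w} : Finset (Fin n)) ∈ S.faces) ∧
  ¬ ∃ w z : Fin n, ({u, v, w} : Finset (Fin n)) ∈ S.faces ∧
      ({u, v, z} : Finset (Fin n)) ∈ S.faces ∧ w ≠ z ∧
      ({u, w, z} : Finset (Fin n)) ∈ S.faces ∧ ({v, w, z} : Finset (Fin n)) ∈ S.faces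

/-- A triangulated surface is irreducible if it has no contractible edge. -/
def TriSurface.Irreducible {n : ℕ} (S : TriSurface n) : Prop :=
  ¬ ∃ u v : Fin n, S.Contractible u v

/-- The simplices of the complex: the nonempty subsets of triangles. -/
def TriSurface.IsSimplex {n : ℕ} (S : TriSurface n) (σ : Finset (Fin n)) : Prop :=
  σ.Nonempty ∧ ∃ f ∈ S.faces, σ ⊆ f

/-- A geometric realization in ℝ³: each triangle is mapped to affinely independent points,
and the convex hulls of the point sets of any two simplices of the complex intersect
exactly in the convex hull of the points of their common vertices. -/
def TriSurface.IsRealization {n : ℕ} (S : TriSurface n) (p : Fin n → (Fin 3 → ℝ)) : Prop :=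
  (∀ f ∈ S.faces, AffineIndependent ℝ (fun x : {x // x ∈ f} => p x.1)) ∧
  ∀ σ τ : Finset (Fin n), S.IsSimplex σ → S.IsSimplex τ →
    convexHull ℝ (p '' ↑σ) ∩ convexHull ℝ (p '' ↑τ) = convexHull ℝ (p '' ↑(σ ∩ τ))

/-- Neighborly: every pair of distinct vertices forms an edge. -/
def TriSurface.Neighborly {n : ℕ} (S : TriSurface n) : Prop :=
  ∀ u v : Fin n, u ≠ v → ({u, v} : Finset (Fin n)) ∈ S.edges

namespace TriSurface

variable {n : ℕ} (S : TriSurface n)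

theorem edge_subset_card {e : Finset (Fin n)} (he : e ∈ S.edges) :
    (S.faces.filter (fun f => e ⊆ f)).card = 2 := by
  simp only [edges, Finset.mem_filter, Finset.mem_univ, true_and] at he
  obtain ⟨hc, f, hf, hef⟩ := he
  obtain ⟨u, v, huv, rfl⟩ := Finset.card_eq_two.1 hc
  have h := S.edge_two u v huv ⟨f, hf, hef (by simp), hef (by simp)⟩
  rw [← h]
  congr 1
  ext g
  simp [Finset.insert_subset_iff]

theorem two_mul_card_edges : 2 * S.edges.card = 3 * S.faces.card := by
  have h := Finset.card_mul_eq_card_mul (s := S.edges) (t := S.faces) (m := 2) (n := 3)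
    (fun e f : Finset (Fin n) => e ⊆ f)
    (fun e he => by
      rw [← S.edge_subset_card he]
      congr 1) (fun f hf => by
      have : Finset.bipartiteBelow (fun e f => e ⊆ f) S.edges f = Finset.powersetCard 2 f := by
        ext e
        simp only [Finset.bipartiteBelow, edges, Finset.mem_filter, Finset.mem_univ, true_and,
          Finset.mem_powersetCard]
        exact ⟨fun h => ⟨h.2, h.1.1⟩, fun h => ⟨⟨h.2, f, hf, h.1⟩, h.1⟩⟩
      rw [this, Finset.card_powersetCard, S.card_eq f hf]
      rfl)
  omega

theorem card_faces_of_eulerChar {S : TriSurface 6} (hS : S.eulerChar = 1) :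
    S.faces.card = 10 := by
  have h := S.two_mul_card_edges
  simp only [eulerChar] at hS
  omega

theorem neighborly_of_eulerChar {S : TriSurface 6} (hS : S.eulerChar = 1) : S.Neighborly := by
  intro u v huv
  have h := S.two_mul_card_edges
  have h15 : S.edges.card = 15 := by
    simp only [eulerChar] at hS
    omega
  have hsub : S.edges ⊆ Finset.powersetCard 2 Finset.univ := by
    intro e he
    simp only [edges, Finset.mem_filter] at he
    simp [Finset.mem_powersetCard, he.2.1]
  have heq := Finset.eq_of_subset_of_card_le hsub (by
    rw [h15, Finset.card_powersetCard]
    rfl)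
  rw [heq, Finset.mem_powersetCard]
  exact ⟨Finset.subset_univ _, Finset.card_pair huv⟩

/-- The vertices `a`, `b`, `c` span a triangle of the surface. -/
def IsFace (a b c : Fin n) : Prop := ({a, b, c} : Finset (Fin n)) ∈ S.faces

variable {S}

theorem IsFace.swap {a b c : Fin n} (h : S.IsFace a b c) : S.IsFace b a c := by
  rwa [IsFace, Finset.insert_comm]

theorem IsFace.swap_right {a b c : Fin n} (h : S.IsFace a b c) : S.IsFace a c b := by
  rwa [IsFace, Finset.pair_comm]

theorem IsFace.rotate {a b c : Fin n} (h : S.IsFace a b c) : S.IsFace b c a :=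
  h.swap.swap_right

theorem IsFace.pairwise_ne {a b c : Fin n} (h : S.IsFace a b c) : a ≠ b ∧ a ≠ c ∧ b ≠ c :=
  Finset.card_triple_eq_three_iff.1 (S.card_eq _ h)

theorem exists_isFace_of_mem {f : Finset (Fin n)} (hf : f ∈ S.faces) {u v : Fin n} (huv : u ≠ v)
    (hu : u ∈ f) (hv : v ∈ f) : ∃ w, f = {u, v, w} ∧ S.IsFace u v w := by
  have h1 : ({u, v} : Finset (Fin n)) ⊆ f := by simp [Finset.insert_subset_iff, hu, hv]
  have h2 : (f \ {u, v}).card = 1 := by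
    rw [Finset.card_sdiff_of_subset h1, S.card_eq f hf, Finset.card_pair huv]
  obtain ⟨w, hw⟩ := Finset.card_eq_one.1 h2
  have hfw : f = {u, v, w} := by
    rw [← Finset.union_sdiff_of_subset h1, hw]
    ext x
    simp
  exact ⟨w, hfw, by rwa [IsFace, ← hfw]⟩

theorem Neighborly.exists_isFace (hN : S.Neighborly) {u v : Fin n} (huv : u ≠ v) :
    ∃ w, S.IsFace u v w := by
  have h := hN u v huv
  simp only [edges, Finset.mem_filter, Finset.mem_univ, true_and] at h
  obtain ⟨-, f, hf, hs⟩ := h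
  obtain ⟨w, -, hw⟩ := exists_isFace_of_mem hf huv (hs (by simp)) (hs (by simp))
  exact ⟨w, hw⟩

theorem IsFace.exists_other {u v w : Fin n} (h : S.IsFace u v w) :
    ∃ z, z ≠ w ∧ S.IsFace u v z ∧ ∀ x, S.IsFace u v x → x = w ∨ x = z := by
  have huv := h.pairwise_ne.1
  have hcard := S.edge_two u v huv ⟨_, h, by simp, by simp⟩
  have hmem : ∀ x, S.IsFace u v x → ({u, v, x} : Finset (Fin n)) ∈
      S.faces.filter (fun f => u ∈ f ∧ v ∈ f) := fun x hx =>
    Finset.mem_filter.2 ⟨hx, by simp, by simp⟩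
  have hinj : ∀ x y, S.IsFace u v x → ({u, v, x} : Finset (Fin n)) = {u, v, y} → x = y := by
    intro x y hx hxy
    have : x ∈ ({u, v, y} : Finset (Fin n)) := by rw [← hxy]; simp
    have := hx.pairwise_ne
    grind
  obtain ⟨g, hg, hne⟩ := Finset.exists_mem_ne (by omega) ({u, v, w} : Finset (Fin n))
    (s := S.faces.filter (fun f => u ∈ f ∧ v ∈ f))
  have hg' := Finset.mem_filter.1 hg
  obtain ⟨z, rfl, hz⟩ := exists_isFace_of_mem hg'.1 huv hg'.2.1 hg'.2.2
  refine ⟨z, fun hzw => hne (by rw [hzw]), hz, fun x hx => ?_⟩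
  by_contra! hcon
  have h3 : ({{u, v, w}, {u, v, z}, {u, v, x}} : Finset (Finset (Fin n))).card = 3 :=
    Finset.card_triple_eq_three_iff.2 ⟨hne.symm, fun he => hcon.1 (hinj _ _ hx he.symm),
      fun he => hcon.2 (hinj _ _ hx he.symm)⟩
  have hle := Finset.card_le_card (s := {{u, v, w}, {u, v, z}, {u, v, x}})
    (t := S.faces.filter (fun f => u ∈ f ∧ v ∈ f)) (by
      simp only [Finset.insert_subset_iff, Finset.singleton_subset_iff]
      exact ⟨hmem _ h, hmem _ hz, hmem _ hx⟩)
  omega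

theorem IsFace.eq_or_eq {u v w z x : Fin n} (hw : S.IsFace u v w) (hz : S.IsFace u v z)
    (hwz : w ≠ z) (hx : S.IsFace u v x) : x = w ∨ x = z := by
  obtain ⟨y, -, -, h⟩ := hw.exists_other
  have := h z hz
  have := h x hx
  grind

/-- In a neighborly surface, a nonempty set of vertices of the link of `v` that is closed under
adjacency in the link consists of all vertices other than `v`. -/
theorem Neighborly.mem_of_closed (hN : S.Neighborly) {v a : Fin n} {A : Set (Fin n)}
    (hav : a ≠ v) (ha : a ∈ A) (hA : ∀ x ∈ A, ∀ y, S.IsFace v x y → y ∈ A)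
    {b : Fin n} (hb : b ≠ v) : b ∈ A := by
  have key : ∀ c, c ≠ v → ∃ f ∈ S.faces, v ∈ f ∧ c ∈ f ∧ c ≠ v := by
    intro c hc
    obtain ⟨w, hw⟩ := hN.exists_isFace hc.symm
    exact ⟨_, hw, by simp, by simp, hc⟩
  have h := S.link_cycle v a b (key a hav) (key b hb)
  clear hb
  induction h with
  | refl => exact ha
  | tail _ hxy ih => exact hA _ ih _ hxy.2.2.2

theorem Neighborly.card_link_le (hN : S.Neighborly) {v a : Fin n} {A : Finset (Fin n)}
    (hav : a ≠ v) (ha : a ∈ A) (hA : ∀ x ∈ A, ∀ y, S.IsFace v x y → y ∈ A) :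
    n ≤ A.card + 1 := by
  have h : Finset.univ ⊆ insert v A := fun b _ => by
    by_cases hb : b = v
    · simp [hb]
    · exact Finset.mem_insert_of_mem (hN.mem_of_closed (A := (A : Set (Fin n))) hav ha hA hb)
  simpa using (Finset.card_le_card h).trans (Finset.card_insert_le _ _)

theorem Neighborly.not_link_three_cycle (hN : S.Neighborly) (hn : 5 ≤ n) {v a b c : Fin n}
    (hab : S.IsFace v a b) (hbc : S.IsFace v b c) (hca : S.IsFace v c a) : False := by
  have h1 := hab.pairwise_ne
  have h2 := hbc.pairwise_ne
  have h3 := hca.pairwise_ne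
  have h := hN.card_link_le (v := v) (a := a) (A := {a, b, c}) h1.1.symm (by simp) (by
    intro x hx y hy
    simp only [Finset.mem_insert, Finset.mem_singleton] at hx ⊢
    rcases hx with rfl | rfl | rfl
    · have := hab.eq_or_eq hca.swap_right h2.2.2 hy
      tauto
    · have := hab.swap_right.eq_or_eq hbc h3.2.2.symm hy
      tauto
    · have := hbc.swap_right.eq_or_eq hca h1.2.2.symm hy
      tauto)
  have := Finset.card_le_three (a := a) (b := b) (c := c)
  omega

theorem Neighborly.not_link_four_cycle (hN : S.Neighborly) (hn : 6 ≤ n) {v a b c d : Fin n}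
    (hab : S.IsFace v a b) (hbc : S.IsFace v b c) (hcd : S.IsFace v c d) (hda : S.IsFace v d a)
    (hac : a ≠ c) (hbd : b ≠ d) : False := by
  have h := hN.card_link_le (v := v) (a := a) (A := {a, b, c, d}) hab.pairwise_ne.1.symm
    (by simp) (by
    intro x hx y hy
    simp only [Finset.mem_insert, Finset.mem_singleton] at hx ⊢
    rcases hx with rfl | rfl | rfl | rfl
    · have := hab.eq_or_eq hda.swap_right hbd hy
      tauto
    · have := hab.swap_right.eq_or_eq hbc hac hy
      tauto
    · have := hbc.swap_right.eq_or_eq hcd hbd hy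
      tauto
    · have := hcd.swap_right.eq_or_eq hda hac.symm hy
      tauto)
  have := Finset.card_le_four (a := a) (b := b) (c := c) (d := d)
  omega

/-- If `o, a, b, c, d, e` are the six vertices of a neighborly surface and `e - a - b - c` is a
path in the link of `o`, then the second triangle at the edge `ab` is `abd`. -/
theorem Neighborly.isFace_opposite {S : TriSurface 6} (hN : S.Neighborly) {o a b c d e : Fin 6}
    (hinj : Function.Injective ![o, a, b, c, d, e])
    (hea : S.IsFace o e a) (hab : S.IsFace o a b) (hbc : S.IsFace o b c) : S.IsFace a b d := by
  obtain ⟨x, hxo, hx, -⟩ := hab.rotate.exists_other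
  have hxr : x ∈ Set.range ![o, a, b, c, d, e] :=
    (Finite.injective_iff_surjective.1 hinj) x
  have hne := hx.pairwise_ne
  simp only [Set.mem_range, Fin.exists_fin_succ, Matrix.cons_val_zero, Matrix.cons_val_succ,
    IsEmpty.exists_iff, or_false] at hxr
  rcases hxr with rfl | rfl | rfl | rfl | rfl | rfl
  · exact absurd rfl hxo
  · exact absurd rfl hne.2.1
  · exact absurd rfl hne.2.2
  · exact (hN.not_link_three_cycle (by omega) hab.rotate.swap hbc.swap hx.rotate).elim
  · exact hx
  · exact (hN.not_link_three_cycle (by omega) hab.swap hx hea.rotate.rotate.swap_right).elim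

/-- The link of a vertex of a neighborly surface with six vertices is a pentagon. -/
theorem Neighborly.exists_link_pentagon {S : TriSurface 6} (hN : S.Neighborly) (o : Fin 6) :
    ∃ a b c d e, Function.Injective ![o, a, b, c, d, e] ∧ S.IsFace o a b ∧ S.IsFace o b c ∧
      S.IsFace o c d ∧ S.IsFace o d e ∧ S.IsFace o e a := by
  obtain ⟨a, ha⟩ := exists_ne o
  obtain ⟨b, hab⟩ := hN.exists_isFace ha.symm
  obtain ⟨e, heb, hae, -⟩ := hab.exists_other
  obtain ⟨c, hca, hbc, -⟩ := hab.swap_right.exists_other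
  have hce : c ≠ e := by
    rintro rfl
    exact hN.not_link_three_cycle (by omega) hab hbc hae.swap_right
  obtain ⟨d, hdb, hcd, -⟩ := hbc.swap_right.exists_other
  have h1 := hab.pairwise_ne
  have h2 := hbc.pairwise_ne
  have h3 := hcd.pairwise_ne
  have h4 := hae.pairwise_ne
  have hda : d ≠ a := by
    rintro rfl
    have := hab.eq_or_eq hae heb.symm hcd.swap_right
    grind
  have hde : d ≠ e := by
    rintro rfl
    exact hN.not_link_four_cycle (by omega) hab hbc hcd hae.swap_right hca.symm heb.symm
  have hinj : Function.Injective ![o, a, b, c, d, e] := by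
    have : List.Nodup [o, a, b, c, d, e] := by
      simp only [List.nodup_cons, List.mem_cons, List.not_mem_nil, List.nodup_nil]
      grind
    intro i j hij
    fin_cases i <;> fin_cases j <;> simp_all
  obtain ⟨x, hxc, hdx, -⟩ := hcd.swap_right.exists_other
  have h5 := hdx.pairwise_ne
  have hxr : x ∈ Set.range ![o, a, b, c, d, e] :=
    (Finite.injective_iff_surjective.1 hinj) x
  have hxe : x = e := by
    simp only [Set.mem_range, Fin.exists_fin_succ, Matrix.cons_val_zero, Matrix.cons_val_succ,
      IsEmpty.exists_iff, or_false] at hxr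
    rcases hxr with rfl | rfl | rfl | rfl | rfl | rfl
    · exact absurd rfl h5.2.1
    · have := hab.eq_or_eq hae heb.symm hdx.swap_right
      grind
    · have := hab.swap_right.eq_or_eq hbc hca.symm hdx.swap_right
      grind
    · exact absurd rfl hxc
    · exact absurd rfl h5.2.2
    · rfl
  exact ⟨a, b, c, d, e, hinj, hab, hbc, hcd, hxe ▸ hdx, hae.swap_right⟩

/-- The ten triangles of the standard six-vertex triangulation of the projective plane. -/
def projectivePlaneFaces : Finset (Finset (Fin 6)) :=
  {{0, 1, 2}, {0, 2, 3}, {0, 3, 4}, {0, 4, 5}, {0, 5, 1},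
    {1, 2, 4}, {2, 3, 5}, {3, 4, 1}, {4, 5, 2}, {5, 1, 3}}

theorem card_projectivePlaneFaces : projectivePlaneFaces.card = 10 := by
  decide

theorem exists_faces_eq_image {S : TriSurface 6} (hS : S.eulerChar = 1) :
    ∃ σ : Equiv.Perm (Fin 6), S.faces = projectivePlaneFaces.image (Finset.image σ) := by
  have hN := neighborly_of_eulerChar hS
  obtain ⟨a, b, c, d, e, hinj, hab, hbc, hcd, hde, hea⟩ := hN.exists_link_pentagon 0
  have hrot : ∀ p q r s t : Fin 6, Function.Injective ![0, p, q, r, s, t] →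
      Function.Injective ![0, q, r, s, t, p] := by
    intro p q r s t h
    have : ![0, q, r, s, t, p] = ![0, p, q, r, s, t] ∘ ![0, 2, 3, 4, 5, 1] := by
      ext i
      fin_cases i <;> rfl
    rw [this]
    exact h.comp (by decide)
  have h1 := hrot _ _ _ _ _ hinj
  have h2 := hrot _ _ _ _ _ h1
  have h3 := hrot _ _ _ _ _ h2
  have h4 := hrot _ _ _ _ _ h3
  have habd := hN.isFace_opposite hinj hea hab hbc
  have hbce := hN.isFace_opposite h1 hab hbc hcd
  have hcda := hN.isFace_opposite h2 hbc hcd hde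
  have hdeb := hN.isFace_opposite h3 hcd hde hea
  have heac := hN.isFace_opposite h4 hde hea hab
  let σ : Equiv.Perm (Fin 6) := Equiv.ofBijective _ (Finite.injective_iff_bijective.1 hinj)
  refine ⟨σ, (Finset.eq_of_subset_of_card_le ?_ ?_).symm⟩
  · intro f hf
    obtain ⟨g, hg, rfl⟩ := Finset.mem_image.1 hf
    simp only [projectivePlaneFaces, Finset.mem_insert, Finset.mem_singleton] at hg
    rcases hg with rfl | rfl | rfl | rfl | rfl | rfl | rfl | rfl | rfl | rfl <;>
      simpa only [Finset.image_insert, Finset.image_singleton]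
  · rw [Finset.card_image_of_injective _ (Finset.image_injective σ.injective),
      card_faces_of_eulerChar hS, card_projectivePlaneFaces]

end TriSurface

/-- Any two triangulated surfaces with 6 vertices and Euler characteristic 1 are
combinatorially isomorphic: the 6-vertex triangulation of the real projective plane
is unique. -/
theorem six_vertex_projective_plane_unique (S T : TriSurface 6)
    (hS : S.eulerChar = 1) (hT : T.eulerChar = 1) : S.Iso T := by
  obtain ⟨σ, hσ⟩ := TriSurface.exists_faces_eq_image hS
  obtain ⟨τ, hτ⟩ := TriSurface.exists_faces_eq_image hT
  refine ⟨σ.symm.trans τ, fun f => ?_⟩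
  have himage : (f.image σ.symm).image σ = f := by
    simp [Finset.image_image]
  have hcomp : f.image (σ.symm.trans τ) = (f.image σ.symm).image τ := by
    rw [Finset.image_image, Equiv.coe_trans]
  rw [hcomp, hτ, (Finset.image_injective τ.injective).mem_finset_image, hσ]
  conv_lhs => rw [← himage]
  rw [(Finset.image_injective σ.injective).mem_finset_image]
end

section
/- Every orientable triangulated surface with Euler characteristic −2 (i.e., every triangulation of the orientable surface of genus 2) has at least 10 vertices, even though the Heawood bound only requires 9 vertices in this case. -/
open scoped Classical

namespace RotationSearch

/-! ### An exhaustive search for oriented triangulations on the labels `0, …, 8`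

A table of third vertices is a natural number read in base 16. Its entry at `9 * a + b` is `0` if
nothing is decided about the directed edge `(a, b)`, it is `c + 1` if `(a, b, c)` is an oriented
triangle, and it is `10` if `a` and `b` are not joined by an edge. -/

/-- The entry of the table `T` at position `i`. -/
def entry (T i : ℕ) : ℕ := (T >>> (4 * i)) % 16

/-- The table `T` with the value `v` written at position `i`. -/
def record (T i v : ℕ) : ℕ := T ||| (v <<< (4 * i))

/-- The table `T` has an entry at position `i` that is different from `v`. -/
def clash (T i v : ℕ) : Bool :=
  match entry T i with
  | 0 => false
  | u + 1 => !Nat.beq (u + 1) v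

/-- The walk around `v` from `x` reaches `s` after at least one and at most `l` steps. -/
def reachesWithin (T v s : ℕ) : ℕ → ℕ → Bool
  | 0, _ => false
  | l + 1, x =>
    match entry T (9 * v + x) with
    | 0 => false
    | y + 1 => Nat.beq y s || reachesWithin T v s l y

/-- Depth-first search through the positions below `n`: the result `true` certifies that the
table `T` cannot be completed in such a way that every link is a cycle of length at least five,
the label `7` is joined to all others, and at most `m` further pairs are not joined. -/
def refutes : ℕ → ℕ → ℕ → Bool
  | 0, _, _ => false
  | n + 1, m, T =>
    match entry T n with
    | 0 =>
      ([0, 1, 2, 3, 4, 5, 6, 7, 8].all fun c =>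
        clash T (9 * (n % 9) + c) (n / 9 + 1) || clash T (9 * c + n / 9) (n % 9 + 1) ||
        let T' := record (record (record T n (c + 1)) (9 * (n % 9) + c) (n / 9 + 1))
          (9 * c + n / 9) (n % 9 + 1)
        reachesWithin T' (n / 9) (n % 9) 4 (n % 9) || reachesWithin T' (n % 9) c 4 c ||
        reachesWithin T' c (n / 9) 4 (n / 9) || refutes n m T') &&
      (Nat.beq (n / 9) 7 ||
        match m with
        | 0 => true
        | m + 1 => clash T (9 * (n % 9) + n / 9) 10 ||
          refutes n m (record (record T n 10) (9 * (n % 9) + n / 9) 10))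
    | _ + 1 => refutes n m T

/-- The entries for the diagonal and for the triangles `(8, i, i + 1)`, `i` modulo `8`. -/
def startEntries : List (ℕ × ℕ) :=
  (List.range 9).map (fun i => (10 * i, 10)) ++
  (List.range 8).flatMap fun i =>
    [(9 * 8 + i, (i + 1) % 8 + 1), (9 * i + (i + 1) % 8, 9), (9 * ((i + 1) % 8) + 8, i + 1)]

/-- The table with which the search starts. -/
def startTable : ℕ := startEntries.foldl (fun T p => record T p.1 p.2) 0

theorem refutes_startTable : refutes 81 3 startTable = true := by decide +kernel

theorem entry_record (T i v j : ℕ) (hv : v < 16) :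
    entry (record T i v) j = entry T j ||| if i = j then v else 0 := by
  have hbit : ∀ k, 4 ≤ k → v.testBit k = false := fun k hk =>
    Nat.testBit_lt_two_pow (hv.trans_le (Nat.pow_le_pow_right (n := 2) (by norm_num) hk))
  apply Nat.eq_of_testBit_eq
  intro k
  rw [entry, entry, record, show 16 = 2 ^ 4 by norm_num, Nat.testBit_or, Nat.testBit_mod_two_pow,
    Nat.testBit_mod_two_pow, Nat.testBit_shiftRight, Nat.testBit_shiftRight, Nat.testBit_or,
    Nat.testBit_shiftLeft]
  by_cases hk : k < 4
  · split_ifs with hij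
    · subst hij
      simp [hk]
    · rcases lt_or_gt_of_ne hij with h | h
      · rw [hbit (4 * j + k - 4 * i) (by omega)]
        simp
      · simp [hk, show ¬ 4 * i ≤ 4 * j + k by omega]
  · split_ifs
    · simp [hk, hbit k (by omega)]
    · simp [hk]

/-- The values `h i` form a complete table, for a surface in which every link is a cycle of
length at least five and the label `7` is joined to all others. -/
structure IsComplete (h : ℕ → ℕ) : Prop where
  pos : ∀ i, 1 ≤ h i
  le : ∀ i, h i ≤ 10
  rotate : ∀ a b c, a < 9 → b < 9 → c < 9 → h (9 * a + b) = c + 1 → h (9 * b + c) = a + 1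
  symm : ∀ a b, a < 9 → b < 9 → h (9 * a + b) = 10 → h (9 * b + a) = 10
  full : ∀ b, b < 9 → h (9 * 7 + b) = 10 → b = 7
  link : ∀ v s, v < 9 → s < 9 → h (9 * v + s) ≠ 10 → ∀ l, 1 ≤ l → l ≤ 4 →
    (fun x => h (9 * v + x) - 1)^[l] s ≠ s

/-- The decided entries of `T` agree with `h`. -/
def Agrees (h : ℕ → ℕ) (T : ℕ) : Prop := ∀ i, entry T i ≠ 0 → entry T i = h i

/-- The diagonal of `T` is decided. -/
def DiagonalDecided (T : ℕ) : Prop := ∀ a < 9, entry T (9 * a + a) ≠ 0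

/-- The pairs that are not joined according to `h` and not yet decided in `T`. -/
def undecidedNonedges (h : ℕ → ℕ) (T : ℕ) : Finset (ℕ × ℕ) :=
  (Finset.range 9 ×ˢ Finset.range 9).filter fun p =>
    h (9 * p.1 + p.2) = 10 ∧ (entry T (9 * p.1 + p.2) = 0 ∨ entry T (9 * p.2 + p.1) = 0) ∧
      p.2 < p.1

variable {h : ℕ → ℕ} {T : ℕ}

theorem Agrees.record (hT : Agrees h T) (hh : IsComplete h) {i v : ℕ} (hv : h i = v) :
    Agrees h (record T i v) := by
  intro j hj
  have := hh.le i
  rw [entry_record _ _ _ _ (by omega)] at hj ⊢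
  split_ifs at hj ⊢ with hij
  · subst hij
    by_cases h0 : entry T i = 0
    · simp [h0, hv]
    · rw [hT i h0, hv, Nat.or_self]
  · simpa using hT j (by simpa using hj)

theorem entry_record_ne_zero {i v j : ℕ} (hv : v < 16) (hj : entry T j ≠ 0) :
    entry (record T i v) j ≠ 0 := by
  rw [entry_record _ _ _ _ hv]
  simp [hj]

theorem entry_record_self_ne_zero {i v : ℕ} (hv : v < 16) (h0 : v ≠ 0) :
    entry (record T i v) i ≠ 0 := by
  rw [entry_record _ _ _ _ hv]
  simp [h0]

theorem DiagonalDecided.record (hT : DiagonalDecided T) {i v : ℕ} (hv : v < 16) :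
    DiagonalDecided (record T i v) :=
  fun a ha => entry_record_ne_zero hv (hT a ha)

theorem undecidedNonedges_record_subset {i v : ℕ} (hv : v < 16) :
    undecidedNonedges h (record T i v) ⊆ undecidedNonedges h T := by
  intro p
  simp only [undecidedNonedges, Finset.mem_filter]
  rintro ⟨hp, h10, h0, hlt⟩
  exact ⟨hp, h10, h0.imp (fun hc => by_contra fun hn => entry_record_ne_zero hv hn hc)
    (fun hc => by_contra fun hn => entry_record_ne_zero hv hn hc), hlt⟩

theorem Agrees.clash_eq_false (hT : Agrees h T) {i v : ℕ} (hv : h i = v) :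
    clash T i v = false := by
  unfold clash
  split
  · rfl
  · next u hu =>
    have := hT i (by omega)
    simp [show u + 1 = v by omega]

theorem Agrees.exists_iterate_eq (hT : Agrees h T) {v s : ℕ} :
    ∀ {l x : ℕ}, reachesWithin T v s l x = true →
      ∃ k, 1 ≤ k ∧ k ≤ l ∧ (fun x => h (9 * v + x) - 1)^[k] x = s
  | 0, _, hl => by simp [reachesWithin] at hl
  | l + 1, x, hl => by
    rw [reachesWithin] at hl
    split at hl
    · simp at hl
    · next y hy =>
      have hxy : h (9 * v + x) - 1 = y := by
        have := hT (9 * v + x) (by omega)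
        omega
      rw [Bool.or_eq_true] at hl
      rcases hl with hl | hl
      · exact ⟨1, le_rfl, by omega, by simpa [hxy] using hl⟩
      · obtain ⟨k, hk, hkl, hks⟩ := hT.exists_iterate_eq hl
        refine ⟨k + 1, by omega, by omega, ?_⟩
        rw [Function.iterate_succ_apply]
        simpa [hxy] using hks

theorem Agrees.reachesWithin_eq_false (hT : Agrees h T) (hh : IsComplete h) {v s : ℕ}
    (hv : v < 9) (hs : s < 9) (hvs : h (9 * v + s) ≠ 10) : reachesWithin T v s 4 s = false := by
  by_contra hc
  obtain ⟨k, hk, hk4, hks⟩ := hT.exists_iterate_eq (Bool.eq_true_of_not_eq_false hc)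
  exact hh.link v s hv hs hvs k hk hk4 hks

theorem card_undecidedNonedges_lt (hh : IsComplete h) {a b : ℕ} (ha : a < 9) (hb : b < 9)
    (hab : a ≠ b) (h10 : h (9 * a + b) = 10) (h0 : entry T (9 * a + b) = 0) :
    (undecidedNonedges h (record (record T (9 * a + b) 10) (9 * b + a) 10)).card <
      (undecidedNonedges h T).card := by
  have hsub : undecidedNonedges h (record (record T (9 * a + b) 10) (9 * b + a) 10) ⊆
      undecidedNonedges h T :=
    (undecidedNonedges_record_subset (by norm_num)).trans
      (undecidedNonedges_record_subset (by norm_num))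
  have hab' : entry (record (record T (9 * a + b) 10) (9 * b + a) 10) (9 * a + b) ≠ 0 :=
    entry_record_ne_zero (by norm_num) (entry_record_self_ne_zero (by norm_num) (by norm_num))
  have hba' : entry (record (record T (9 * a + b) 10) (9 * b + a) 10) (9 * b + a) ≠ 0 :=
    entry_record_self_ne_zero (by norm_num) (by norm_num)
  have h10' := hh.symm a b ha hb h10
  apply Finset.card_lt_card
  rw [Finset.ssubset_iff_of_subset hsub]
  rcases lt_or_gt_of_ne hab with hlt | hlt
  · exact ⟨(b, a), by simp [undecidedNonedges, *], by simp [undecidedNonedges, hab', hba']⟩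
  · exact ⟨(a, b), by simp [undecidedNonedges, *], by simp [undecidedNonedges, hab', hba']⟩

theorem not_refutes (hh : IsComplete h) : ∀ {n m T : ℕ}, n ≤ 81 → Agrees h T →
    DiagonalDecided T → (undecidedNonedges h T).card ≤ m → refutes n m T = false
  | 0, _, _, _, _, _, _ => rfl
  | n + 1, m, T, hn, hT, hdiag, hm => by
    rw [refutes.eq_def]
    dsimp only
    split
    swap
    · exact not_refutes hh (by omega) hT hdiag hm
    next h0 =>
    obtain ⟨a, b, ha, hb, rfl⟩ : ∃ a b, a < 9 ∧ b < 9 ∧ n = 9 * a + b :=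
      ⟨n / 9, n % 9, by omega, by omega, by omega⟩
    have hdiv : (9 * a + b) / 9 = a := by omega
    have hmod : (9 * a + b) % 9 = b := by omega
    rw [hdiv, hmod, Bool.and_eq_false_iff]
    have hpos := hh.pos (9 * a + b)
    have hle := hh.le (9 * a + b)
    by_cases h10 : h (9 * a + b) = 10
    · right
      have hab : a ≠ b := by
        rintro rfl
        exact hdiag a ha h0
      have hcard := card_undecidedNonedges_lt hh ha hb hab h10 h0
      rw [Bool.or_eq_false_iff]
      constructor
      · rw [← Bool.not_eq_true, Nat.beq_eq]
        rintro rfl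
        exact hab (hh.full b hb h10).symm
      · have h10' := hh.symm a b ha hb h10
        split
        · omega
        · rw [hT.clash_eq_false h10', Bool.false_or]
          exact not_refutes hh (by omega) ((hT.record hh h10).record hh h10')
            ((hdiag.record (by norm_num)).record (by norm_num)) (by omega)
    · left
      obtain ⟨c, hc, habc⟩ : ∃ c < 9, h (9 * a + b) = c + 1 :=
        ⟨h (9 * a + b) - 1, by omega, by omega⟩
      have hbca := hh.rotate a b c ha hb hc habc
      have hcab := hh.rotate b c a hb hc ha hbca
      have hT' := ((hT.record hh habc).record hh hbca).record hh hcab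
      rw [List.all_eq_false]
      refine ⟨c, by simp; omega, ?_⟩
      rw [Bool.not_eq_true, hT.clash_eq_false hbca, hT.clash_eq_false hcab]
      simp only [Bool.false_or]
      rw [hT'.reachesWithin_eq_false hh ha hb (by omega),
        hT'.reachesWithin_eq_false hh hb hc (by omega),
        hT'.reachesWithin_eq_false hh hc ha (by omega)]
      refine not_refutes hh (by omega) hT'
        (((hdiag.record (by omega)).record (by omega)).record (by omega)) (le_trans ?_ hm)
      exact Finset.card_le_card ((undecidedNonedges_record_subset (by omega)).trans
        ((undecidedNonedges_record_subset (by omega)).trans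
        (undecidedNonedges_record_subset (by omega))))

theorem Agrees.foldl (hh : IsComplete h) : ∀ {l : List (ℕ × ℕ)} {T : ℕ}, Agrees h T →
    (∀ p ∈ l, h p.1 = p.2) → Agrees h (l.foldl (fun T p => RotationSearch.record T p.1 p.2) T)
  | [], _, hT, _ => hT
  | p :: l, T, hT, hl =>
    Agrees.foldl (T := RotationSearch.record T p.1 p.2) hh (hT.record hh (hl p (by simp)))
      fun q hq => hl q (by simp [hq])

/-- No complete table with at most three nonedges contains the triangles around a vertex `8` that
is joined to all others. -/
theorem three_lt_card_nonedges (hh : IsComplete h) (hstart : ∀ p ∈ startEntries, h p.1 = p.2) :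
    3 < ((Finset.range 9 ×ˢ Finset.range 9).filter fun p : ℕ × ℕ =>
      h (9 * p.1 + p.2) = 10 ∧ p.2 < p.1).card := by
  by_contra! hcard
  have hT : Agrees h startTable :=
    Agrees.foldl hh (fun i hi => absurd (by simp [entry]) hi) hstart
  have hsub : (undecidedNonedges h startTable).card ≤ 3 := by
    refine le_trans (Finset.card_le_card fun p => ?_) hcard
    simp only [undecidedNonedges, Finset.mem_filter]
    tauto
  have := not_refutes hh le_rfl hT (by unfold DiagonalDecided; decide +kernel) hsub
  simp [refutes_startTable] at this

end RotationSearch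

namespace TriSurface

variable {n : ℕ} (S : TriSurface n)

theorem three_mul_card_faces : 3 * S.faces.card = 2 * S.edges.card := by
  have hcount := Finset.sum_card_bipartiteAbove_eq_sum_card_bipartiteBelow
    (s := S.faces) (t := S.edges) (fun f e => e ⊆ f)
  have hface : ∀ f ∈ S.faces, (S.edges.bipartiteAbove (fun f e => e ⊆ f) f).card = 3 := by
    intro f hf
    have : S.edges.bipartiteAbove (fun f e => e ⊆ f) f = f.powersetCard 2 := by
      ext e
      simp only [Finset.bipartiteAbove, edges, Finset.mem_filter, Finset.mem_univ, true_and,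
        Finset.mem_powersetCard]
      exact ⟨fun h => ⟨h.2, h.1.1⟩, fun h => ⟨⟨h.2, f, hf, h.1⟩, h.1⟩⟩
    rw [this, Finset.card_powersetCard, S.card_eq f hf]
    rfl
  have hedge : ∀ e ∈ S.edges, (S.faces.bipartiteBelow (fun f e => e ⊆ f) e).card = 2 := by
    intro e he
    simp only [edges, Finset.mem_filter, Finset.mem_univ, true_and] at he
    obtain ⟨h2, f, hf, hef⟩ := he
    obtain ⟨u, v, huv, rfl⟩ := Finset.card_eq_two.mp h2
    simp only [Finset.insert_subset_iff, Finset.singleton_subset_iff] at hef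
    simpa only [Finset.bipartiteBelow, Finset.insert_subset_iff, Finset.singleton_subset_iff]
      using S.edge_two u v huv ⟨f, hf, hef⟩
  rw [Finset.sum_congr rfl hface, Finset.sum_congr rfl hedge] at hcount
  simp only [Finset.sum_const, smul_eq_mul] at hcount
  omega

theorem card_edges_of_eulerChar (hχ : S.eulerChar = -2) : S.edges.card = 3 * (n + 2) := by
  have := S.three_mul_card_faces
  unfold eulerChar at hχ
  omega

theorem edges_subset : S.edges ⊆ Finset.univ.powersetCard 2 := by
  intro e he
  simp only [edges, Finset.mem_filter] at he
  simp [Finset.mem_powersetCard, he.2.1]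

theorem pair_mem_edges {u v : Fin n} (huv : u ≠ v) :
    ({u, v} : Finset (Fin n)) ∈ S.edges ↔ ∃ f ∈ S.faces, u ∈ f ∧ v ∈ f := by
  simp [edges, Finset.card_pair huv, Finset.insert_subset_iff]

/-- The pairs of vertices that are not joined by an edge. -/
noncomputable def nonedges : Finset (Finset (Fin n)) := Finset.univ.powersetCard 2 \ S.edges

theorem card_nonedges_add : S.nonedges.card + S.edges.card = n.choose 2 := by
  rw [nonedges, Finset.card_sdiff_add_card_eq_card S.edges_subset, Finset.card_powersetCard,
    Finset.card_univ, Fintype.card_fin]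

theorem pair_mem_nonedges {u v : Fin n} (huv : u ≠ v) :
    ({u, v} : Finset (Fin n)) ∈ S.nonedges ↔ ¬ ∃ f ∈ S.faces, u ∈ f ∧ v ∈ f := by
  rw [nonedges, Finset.mem_sdiff, S.pair_mem_edges huv]
  simp [Finset.mem_powersetCard, Finset.card_pair huv]

/-- The relation `R a b c`, that `(a, b, c)` is a positively oriented triangle of `S`. -/
structure IsOrientation (R : Fin n → Fin n → Fin n → Prop) : Prop where
  rotate : ∀ {a b c}, R a b c → R b c a
  unique : ∀ {a b c d}, R a b c → R a b d → c = d
  ne : ∀ {a b c}, R a b c → a ≠ b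
  exists_swap : ∀ {a b c}, R a b c → ∃ d, R b a d
  mem_faces : ∀ {a b c}, R a b c → ({a, b, c} : Finset (Fin n)) ∈ S.faces
  exists_of_mem : ∀ {f a b}, f ∈ S.faces → a ∈ f → b ∈ f → a ≠ b →
    ∃ c, f = {a, b, c} ∧ (R a b c ∨ R b a c)

theorem Orientable.exists_isOrientation {S : TriSurface n} (hS : S.Orientable) :
    ∃ R, S.IsOrientation R := by
  obtain ⟨ω, hω, hdisj⟩ := hS
  have hrot : ∀ {a b c : Fin n}, ({a, b, c} : Finset (Fin n)) = {b, c, a} := by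
    intro a b c; ext; simp; tauto
  have hrot' : ∀ {a b c : Fin n}, ({(a, b), (b, c), (c, a)} : Finset (Fin n × Fin n)) =
      {(b, c), (c, a), (a, b)} := by
    intro a b c; ext; simp; tauto
  let R : Fin n → Fin n → Fin n → Prop := fun a b c => a ≠ b ∧ a ≠ c ∧ b ≠ c ∧
    ({a, b, c} : Finset (Fin n)) ∈ S.faces ∧ ω {a, b, c} = {(a, b), (b, c), (c, a)}
  have rotate : ∀ {a b c}, R a b c → R b c a := fun ⟨hab, hac, hbc, hf, hw⟩ =>
    ⟨hbc, hab.symm, hac.symm, hrot ▸ hf, by rw [← hrot, ← hrot']; exact hw⟩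
  have key : ∀ {f a b}, f ∈ S.faces → a ∈ f → b ∈ f → a ≠ b →
      ∃ c, f = {a, b, c} ∧ (R a b c ∨ R b a c) := by
    intro f a b hf ha hb hab
    obtain ⟨x, y, z, hxy, hxz, hyz, rfl, hw⟩ := hω f hf
    have h1 : R x y z := ⟨hxy, hxz, hyz, hf, hw⟩
    have h2 := rotate h1
    have h3 := rotate h2
    simp only [Finset.mem_insert, Finset.mem_singleton] at ha hb
    have hperm : ∀ {a b c : Fin n}, ({a, b, c} : Finset (Fin n)) = {b, a, c} :=
      Finset.insert_comm _ _ _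
    rcases ha with rfl | rfl | rfl <;> rcases hb with rfl | rfl | rfl
    · exact absurd rfl hab
    · exact ⟨z, rfl, Or.inl h1⟩
    · exact ⟨y, by rw [hrot, hrot, hperm], Or.inr h3⟩
    · exact ⟨z, hperm, Or.inr h1⟩
    · exact absurd rfl hab
    · exact ⟨x, hrot, Or.inl h2⟩
    · exact ⟨y, hrot.symm, Or.inl h3⟩
    · exact ⟨x, by rw [hrot, hperm], Or.inr h2⟩
    · exact absurd rfl hab
  have face_eq : ∀ {a b c d}, R a b c → R a b d → ({a, b, c} : Finset (Fin n)) = {a, b, d} := by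
    intro a b c d h1 h2
    by_contra hne
    exact hdisj _ h1.2.2.2.1 _ h2.2.2.2.1 hne (a, b) (by simp [h1.2.2.2.2])
      (by simp [h2.2.2.2.2])
  refine ⟨R, rotate, ?_, fun h => h.1, ?_, fun h => h.2.2.2.1, key⟩
  · intro a b c d h1 h2
    have hc : c ∈ ({a, b, d} : Finset (Fin n)) := face_eq h1 h2 ▸ by simp
    simpa [h1.2.1.symm, h1.2.2.1.symm] using hc
  · intro a b c h
    have h2 := S.edge_two a b h.1 ⟨_, h.2.2.2.1, by simp, by simp⟩
    obtain ⟨f, g, hfg, heq⟩ := Finset.card_eq_two.mp h2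
    have hf : f ∈ S.faces ∧ a ∈ f ∧ b ∈ f := by
      simpa using (heq ▸ by simp : f ∈ S.faces.filter fun f => a ∈ f ∧ b ∈ f)
    have hg : g ∈ S.faces ∧ a ∈ g ∧ b ∈ g := by
      simpa using (heq ▸ by simp : g ∈ S.faces.filter fun f => a ∈ f ∧ b ∈ f)
    obtain ⟨c, rfl, hc | hc⟩ := key hf.1 hf.2.1 hf.2.2 h.1
    · obtain ⟨d, rfl, hd | hd⟩ := key hg.1 hg.2.1 hg.2.2 h.1
      · exact absurd (face_eq hc hd) hfg
      · exact ⟨d, hd⟩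
    · exact ⟨c, hc⟩

namespace IsOrientation

variable {S} {R : Fin n → Fin n → Fin n → Prop}

theorem exists_iff (hR : S.IsOrientation R) {a b : Fin n} (hab : a ≠ b) :
    (∃ c, R a b c) ↔ ∃ f ∈ S.faces, a ∈ f ∧ b ∈ f := by
  constructor
  · rintro ⟨c, hc⟩
    exact ⟨_, hR.mem_faces hc, by simp, by simp⟩
  · rintro ⟨f, hf, ha, hb⟩
    obtain ⟨c, -, hc | hc⟩ := hR.exists_of_mem hf ha hb hab
    · exact ⟨c, hc⟩
    · exact hR.exists_swap hc

theorem pair_mem_nonedges (hR : S.IsOrientation R) {a b : Fin n} (hab : a ≠ b) :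
    ({a, b} : Finset (Fin n)) ∈ S.nonedges ↔ ¬ ∃ c, R a b c := by
  rw [S.pair_mem_nonedges hab, hR.exists_iff hab]

/-- The successor of `x` in the link of `v`, with the value `x` outside of the link. -/
noncomputable def next (R : Fin n → Fin n → Fin n → Prop) (v x : Fin n) : Fin n :=
  if h : ∃ c, R v x c then h.choose else x

theorem next_eq (hR : S.IsOrientation R) {v x c : Fin n} (h : R v x c) : next R v x = c := by
  have hex : ∃ c, R v x c := ⟨c, h⟩
  rw [next, dif_pos hex]
  exact hR.unique hex.choose_spec h

theorem rel_next {v x : Fin n} (h : ∃ c, R v x c) : R v x (next R v x) := by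
  rw [next, dif_pos h]
  exact h.choose_spec

theorem exists_rel_next (hR : S.IsOrientation R) {v x : Fin n} (h : ∃ c, R v x c) :
    ∃ c, R v (next R v x) c :=
  hR.exists_swap (hR.rotate (hR.rotate (rel_next h)))

theorem exists_rel_iterate_next (hR : S.IsOrientation R) {v x : Fin n} (h : ∃ c, R v x c) :
    ∀ k, ∃ c, R v ((next R v)^[k] x) c
  | 0 => h
  | k + 1 => by
    rw [Function.iterate_succ_apply']
    exact hR.exists_rel_next (hR.exists_rel_iterate_next h k)

theorem next_injective (hR : S.IsOrientation R) (v : Fin n) : Function.Injective (next R v) := by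
  intro x y hxy
  by_cases hx : ∃ c, R v x c <;> by_cases hy : ∃ c, R v y c
  · have h1 := hR.rotate (hR.rotate (rel_next hx))
    have h2 := hR.rotate (hR.rotate (rel_next hy))
    rw [← hxy] at h2
    exact hR.unique h1 h2
  · have := hR.exists_rel_next hx
    rw [hxy, next, dif_neg hy] at this
    exact absurd this hy
  · have := hR.exists_rel_next hy
    rw [← hxy, next, dif_neg hx] at this
    exact absurd this hx
  · rwa [next, dif_neg hx, next, dif_neg hy] at hxy

theorem mem_image_iterate (hR : S.IsOrientation R) {v x y : Fin n} {l : ℕ} (hl : 0 < l)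
    (hx : ∃ c, R v x c) (hy : ∃ c, R v y c) (hloop : (next R v)^[l] x = x) :
    y ∈ (Finset.range l).image fun i => (next R v)^[i] x := by
  have hface : ∀ {z}, (∃ c, R v z c) → ∃ f ∈ S.faces, v ∈ f ∧ z ∈ f ∧ z ≠ v := by
    rintro z ⟨c, hc⟩
    exact ⟨_, hR.mem_faces hc, by simp, by simp, (hR.ne hc).symm⟩
  induction S.link_cycle v x y (hface hx) (hface hy) with
  | refl => exact Finset.mem_image.mpr ⟨0, Finset.mem_range.mpr hl, rfl⟩
  | @tail b c _ hbc ih =>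
    obtain ⟨hbc, hbv, hcv, hf⟩ := hbc
    obtain ⟨d, hd, hvb⟩ := hR.exists_of_mem hf (a := v) (b := b) (by simp) (by simp) hbv.symm
    have hdc : d = c := by
      have : c ∈ ({v, b, d} : Finset (Fin n)) := hd ▸ by simp
      simpa [hcv, hbc.symm, eq_comm] using this
    subst hdc
    have hb : ∃ c, R v b c := hvb.elim (fun h => ⟨_, h⟩) fun h => hR.exists_swap h
    obtain ⟨i, hi, rfl⟩ := Finset.mem_image.mp (ih hb)
    rw [Finset.mem_range] at hi
    rw [Finset.mem_image]
    rcases hvb with h | h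
    · have hnext := hR.next_eq h
      rcases Nat.lt_or_ge (i + 1) l with hil | hil
      · exact ⟨i + 1, Finset.mem_range.mpr hil, by rwa [Function.iterate_succ_apply']⟩
      · obtain rfl : i + 1 = l := by omega
        rw [Function.iterate_succ_apply', hnext] at hloop
        exact ⟨0, Finset.mem_range.mpr hl, hloop.symm⟩
    · have hnext := hR.next_eq (hR.rotate h)
      rcases i with - | i
      · refine ⟨l - 1, Finset.mem_range.mpr (by omega), hR.next_injective v ?_⟩
        rw [← Function.iterate_succ_apply' (next R v), Nat.succ_eq_add_one,
          Nat.sub_add_cancel hl, hloop, hnext]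
        rfl
      · refine ⟨i, Finset.mem_range.mpr (by omega), hR.next_injective v ?_⟩
        rw [← Function.iterate_succ_apply' (next R v), hnext]

/-- The number of neighbours of `v`. -/
noncomputable def degree (R : Fin n → Fin n → Fin n → Prop) (v : Fin n) : ℕ :=
  (Finset.univ.filter fun x => ∃ c, R v x c).card

theorem degree_le_of_iterate (hR : S.IsOrientation R) {v x : Fin n} {l : ℕ} (hl : 0 < l)
    (hx : ∃ c, R v x c) (hloop : (next R v)^[l] x = x) : degree R v ≤ l := by
  refine le_trans (Finset.card_le_card fun y hy => hR.mem_image_iterate hl hx ?_ hloop)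
    (Finset.card_image_le.trans (Finset.card_range l).le)
  simpa using hy

theorem le_degree_add_card_nonedges (hR : S.IsOrientation R) (v : Fin n) :
    n ≤ degree R v + (S.nonedges.card + 1) := by
  have hsplit := Finset.card_filter_add_card_filter_not (s := (Finset.univ : Finset (Fin n)))
    (fun x => ∃ c, R v x c)
  rw [Finset.card_univ, Fintype.card_fin] at hsplit
  have hle : ((Finset.univ.filter fun x => ¬ ∃ c, R v x c).erase v).card ≤ S.nonedges.card := by
    refine Finset.card_le_card_of_injOn (fun x => {v, x}) ?_ ?_
    · intro x hx
      rw [Finset.mem_coe, Finset.mem_erase, Finset.mem_filter] at hx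
      exact (hR.pair_mem_nonedges hx.1.symm).mpr hx.2.2
    · intro x hx y hy hxy
      rw [Finset.mem_coe, Finset.mem_erase] at hx
      have hxy : ({v, x} : Finset (Fin n)) = {v, y} := hxy
      have : x ∈ ({v, y} : Finset (Fin n)) := hxy ▸ by simp
      simpa [hx.1] using this
  have := Finset.pred_card_le_card_erase (s := Finset.univ.filter fun x => ¬ ∃ c, R v x c)
    (a := v)
  unfold degree
  omega

/-- If there are few nonedges, then two vertices are joined to all others. -/
theorem exists_pair_full (hR : S.IsOrientation R) (hn : 2 * S.nonedges.card + 1 < n) :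
    ∃ v w, v ≠ w ∧ (∀ x, x ≠ v → ∃ c, R v x c) ∧ ∀ x, x ≠ w → ∃ c, R w x c := by
  have hcard : (S.nonedges.biUnion id).card ≤ S.nonedges.card * 2 :=
    Finset.card_biUnion_le_card_mul _ _ _ fun e he => by
      rw [nonedges, Finset.mem_sdiff, Finset.mem_powersetCard] at he
      exact he.1.2.le
  have hcompl := Finset.card_compl_add_card (S.nonedges.biUnion id)
  rw [Fintype.card_fin] at hcompl
  obtain ⟨v, hv, w, hw, hvw⟩ := Finset.one_lt_card.mp
    (show 1 < (S.nonedges.biUnion id)ᶜ.card by omega)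
  have key : ∀ v ∈ (S.nonedges.biUnion id)ᶜ, ∀ x, x ≠ v → ∃ c, R v x c := by
    intro v hv x hx
    by_contra hc
    refine Finset.mem_compl.mp hv (Finset.mem_biUnion.mpr
      ⟨_, (hR.pair_mem_nonedges hx.symm).mpr hc, by simp⟩)
  exact ⟨v, w, hvw, key v hv, key w hw⟩

/-- The entry of the table of third vertices of `S`, with vertices labelled by `e`. -/
noncomputable def code (R : Fin n → Fin n → Fin n → Prop) (e : Fin n ≃ Fin n) (a b : Fin n) : ℕ :=
  if ∃ c, R (e a) (e b) c then (e.symm (next R (e a) (e b)) : ℕ) + 1 else n + 1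

theorem code_eq_iff (hR : S.IsOrientation R) (e : Fin n ≃ Fin n) {a b c : Fin n} :
    code R e a b = c + 1 ↔ R (e a) (e b) (e c) := by
  unfold code
  constructor
  · intro h
    split_ifs at h with hab
    · have : e.symm (next R (e a) (e b)) = c := Fin.ext (by omega)
      rw [← this, e.apply_symm_apply]
      exact rel_next hab
    · omega
  · intro h
    rw [if_pos ⟨_, h⟩, hR.next_eq h, e.symm_apply_apply]

theorem code_eq_succ_iff {e : Fin n ≃ Fin n} {a b : Fin n} :
    code R e a b = n + 1 ↔ ¬ ∃ c, R (e a) (e b) c := by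
  unfold code
  split_ifs with h
  · simp only [h, not_true, iff_false]
    omega
  · simp [h]

theorem exists_rel_comm (hR : S.IsOrientation R) {a b : Fin n} :
    (∃ c, R a b c) ↔ ∃ c, R b a c :=
  ⟨fun ⟨_, h⟩ => hR.exists_swap h, fun ⟨_, h⟩ => hR.exists_swap h⟩

theorem iterate_code (hR : S.IsOrientation R) (e : Fin n ≃ Fin n) {v s : Fin n} {g : ℕ → ℕ}
    (hg : ∀ x : Fin n, g x = code R e v x - 1) (hs : ∃ c, R (e v) (e s) c) :
    ∀ k, g^[k] s = e.symm ((next R (e v))^[k] (e s))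
  | 0 => by simp
  | k + 1 => by
    have hk := hR.exists_rel_iterate_next hs k
    rw [Function.iterate_succ_apply', Function.iterate_succ_apply', hR.iterate_code e hg hs k, hg,
      code, e.apply_symm_apply, if_pos hk, Nat.add_sub_cancel]

/-- A labelling of the vertices that lists the link of `v` in cyclic order, beginning with the
successor of `w`, followed by `v` itself. -/
theorem exists_labelling {S : TriSurface (n + 1)}
    {R : Fin (n + 1) → Fin (n + 1) → Fin (n + 1) → Prop}
    (hR : S.IsOrientation R) {v w : Fin (n + 1)} (hvw : v ≠ w)
    (hv : ∀ x, x ≠ v → ∃ c, R v x c) :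
    ∃ e : Fin (n + 1) ≃ Fin (n + 1), e (Fin.last n) = v ∧
      (∀ i : Fin n, e i.castSucc = (next R v)^[i + 1] w) ∧ (next R v)^[n] w = w := by
  have hw := hv w hvw.symm
  have hdeg : degree R v = n := by
    have : (Finset.univ.filter fun x => ∃ c, R v x c) = Finset.univ.erase v := by
      ext x
      simp only [Finset.mem_filter, Finset.mem_univ, true_and, Finset.mem_erase, and_true]
      refine ⟨?_, hv x⟩
      rintro ⟨c, hc⟩
      exact (hR.ne hc).symm
    rw [degree, this, Finset.card_erase_of_mem (Finset.mem_univ v), Finset.card_univ,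
      Fintype.card_fin, Nat.add_sub_cancel]
  have hne : ∀ k, (next R v)^[k] w ≠ v := fun k h => by
    obtain ⟨c, hc⟩ := hR.exists_rel_iterate_next hw k
    exact hR.ne hc h.symm
  have hlt : ∀ i j, i < j → (next R v)^[i] w = (next R v)^[j] w → n ≤ j - i := by
    intro i j hij h
    rw [← hdeg]
    refine hR.degree_le_of_iterate (by omega) hw ((hR.next_injective v).iterate i ?_)
    rw [← Function.iterate_add_apply, Nat.add_sub_cancel' hij.le, h]
  let f : Fin (n + 1) → Fin (n + 1) := Fin.lastCases v fun i => (next R v)^[i + 1] w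
  have hlast : f (Fin.last n) = v := Fin.lastCases_last
  have hcast : ∀ i : Fin n, f i.castSucc = (next R v)^[i + 1] w := fun i => Fin.lastCases_castSucc i
  have hinj : Function.Injective f := by
    intro i j
    induction i using Fin.lastCases with
    | last =>
      induction j using Fin.lastCases with
      | last => simp
      | cast j =>
        rw [hlast, hcast]
        exact fun h => absurd h.symm (hne _)
    | cast i =>
      induction j using Fin.lastCases with
      | last =>
        rw [hlast, hcast]
        exact fun h => absurd h (hne _)
      | cast j =>
        rw [hcast, hcast]
        intro h
        rcases lt_trichotomy (i : ℕ) j with hij | hij | hij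
        · have := hlt _ _ (Nat.succ_lt_succ hij) h
          omega
        · rw [Fin.ext hij]
        · have := hlt _ _ (Nat.succ_lt_succ hij) h.symm
          omega
  let e := Equiv.ofBijective f (Finite.injective_iff_bijective.mp hinj)
  refine ⟨e, hlast, hcast, ?_⟩
  obtain ⟨i, hi⟩ : ∃ i, e i = w := e.surjective w
  induction i using Fin.lastCases with
  | last => exact absurd (hlast.symm.trans hi) hvw
  | cast i =>
    have hi : (next R v)^[i + 1] w = w := (hcast i).symm.trans hi
    have := hlt 0 (i + 1) (by omega) hi.symm
    rwa [show (i : ℕ) + 1 = n by omega] at hi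

end IsOrientation
end TriSurface

namespace TriSurface.IsOrientation

variable {S : TriSurface 9} {R : Fin 9 → Fin 9 → Fin 9 → Prop}

/-- The table of third vertices of `S`, with vertices labelled by `e`. -/
noncomputable def table (R : Fin 9 → Fin 9 → Fin 9 → Prop) (e : Fin 9 ≃ Fin 9) (k : ℕ) : ℕ :=
  code R e (Fin.ofNat 9 (k / 9)) (Fin.ofNat 9 (k % 9))

theorem table_apply (e : Fin 9 ≃ Fin 9) (a b : Fin 9) : table R e (9 * a + b) = code R e a b := by
  have ha : Fin.ofNat 9 ((9 * (a : ℕ) + b) / 9) = a := by ext; simp; omega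
  have hb : Fin.ofNat 9 ((9 * (a : ℕ) + b) % 9) = b := by ext; simp
  rw [table, ha, hb]

theorem table_eq_of_rel (hR : S.IsOrientation R) {e : Fin 9 ≃ Fin 9} {a b c : Fin 9}
    (h : R (e a) (e b) (e c)) : table R e (9 * a + b) = c + 1 := by
  rw [table_apply, hR.code_eq_iff]
  exact h

theorem table_eq_ten_iff {e : Fin 9 ≃ Fin 9} {a b : Fin 9} :
    table R e (9 * a + b) = 10 ↔ ¬ ∃ c, R (e a) (e b) c := by
  rw [table_apply, ← code_eq_succ_iff]

theorem isComplete_table (hR : S.IsOrientation R) {e : Fin 9 ≃ Fin 9}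
    (h7 : ∀ x, x ≠ e 7 → ∃ c, R (e 7) x c) (hdeg : ∀ v, 5 ≤ degree R v) :
    RotationSearch.IsComplete (table R e) where
  pos i := by
    unfold table code
    split_ifs <;> omega
  le i := by
    unfold table code
    split_ifs <;> omega
  rotate a b c ha hb hc h := by
    lift a to Fin 9 using ha
    lift b to Fin 9 using hb
    lift c to Fin 9 using hc
    rw [table_apply, hR.code_eq_iff] at h
    exact hR.table_eq_of_rel (hR.rotate h)
  symm a b ha hb h := by
    lift a to Fin 9 using ha
    lift b to Fin 9 using hb
    rw [table_eq_ten_iff] at h ⊢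
    rwa [hR.exists_rel_comm]
  full b hb h := by
    lift b to Fin 9 using hb
    rw [show (7 : ℕ) = ((7 : Fin 9) : ℕ) from rfl, table_eq_ten_iff] at h
    by_contra hb7
    refine h (h7 _ fun heq => hb7 ?_)
    rw [e.injective heq]
    rfl
  link v s hv hs h l hl hl4 hloop := by
    lift v to Fin 9 using hv
    lift s to Fin 9 using hs
    rw [Ne, table_eq_ten_iff, not_not] at h
    rw [hR.iterate_code e (fun x => by rw [table_apply]) h l, Fin.val_inj,
      Equiv.symm_apply_eq] at hloop
    have := hR.degree_le_of_iterate hl h hloop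
    have := hdeg (e v)
    omega

theorem table_startEntries (hR : S.IsOrientation R) {e : Fin 9 ≃ Fin 9} {w : Fin 9}
    (h8 : ∀ x, x ≠ e 8 → ∃ c, R (e 8) x c)
    (he : ∀ i : Fin 8, e i.castSucc = (next R (e 8))^[i + 1] w)
    (hloop : (next R (e 8))^[8] w = w) :
    ∀ p ∈ RotationSearch.startEntries, table R e p.1 = p.2 := by
  have hrel : ∀ i : Fin 8, R (e 8) (e i.castSucc) (e (i + 1).castSucc) := by
    intro i
    have hnext : e (i + 1).castSucc = next R (e 8) (e i.castSucc) := by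
      rw [he, he, ← Function.iterate_succ_apply' (next R (e 8))]
      rcases Fin.eq_castSucc_or_eq_last i with ⟨j, rfl⟩ | rfl
      · congr 1
        simp
      · simp only [Fin.last_add_one]
        exact congrArg (next R (e 8)) hloop.symm
    rw [hnext]
    refine rel_next (h8 _ fun heq => ?_)
    have := e.injective heq
    rw [Fin.ext_iff] at this
    simp at this
    omega
  have hmod : ∀ i : Fin 8, ((i + 1 : Fin 8).castSucc : ℕ) = ((i : ℕ) + 1) % 8 := fun i => by
    rw [Fin.val_castSucc, Fin.val_add]
    rfl
  intro p hp
  simp only [RotationSearch.startEntries, List.mem_append, List.mem_map, List.mem_flatMap,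
    List.mem_range, List.mem_cons, List.not_mem_nil, or_false] at hp
  rcases hp with ⟨i, hi, rfl⟩ | ⟨i, hi, hp⟩
  · lift i to Fin 9 using hi
    show table R e (10 * i) = 10
    rw [show 10 * (i : ℕ) = 9 * i + i by ring, table_eq_ten_iff]
    rintro ⟨c, hc⟩
    exact hR.ne hc rfl
  · lift i to Fin 8 using hi
    have h1 := hR.table_eq_of_rel (hrel i)
    have h2 := hR.table_eq_of_rel (hR.rotate (hrel i))
    have h3 := hR.table_eq_of_rel (hR.rotate (hR.rotate (hrel i)))
    rw [hmod] at h1 h2 h3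
    rcases hp with rfl | rfl | rfl
    · exact h1
    · exact h2
    · exact h3

theorem card_table_eq_ten_le (hR : S.IsOrientation R) (e : Fin 9 ≃ Fin 9) :
    ((Finset.range 9 ×ˢ Finset.range 9).filter fun p : ℕ × ℕ =>
      table R e (9 * p.1 + p.2) = 10 ∧ p.2 < p.1).card ≤ S.nonedges.card := by
  refine Finset.card_le_card_of_injOn
    (fun p => {e (Fin.ofNat 9 p.1), e (Fin.ofNat 9 p.2)}) ?_ ?_
  · rintro ⟨a, b⟩ hp
    simp only [Finset.coe_filter, Finset.mem_product, Finset.mem_range, Set.mem_ofPred_eq] at hp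
    obtain ⟨⟨ha, hb⟩, h, hlt⟩ := hp
    lift a to Fin 9 using ha
    lift b to Fin 9 using hb
    rw [table_eq_ten_iff] at h
    simpa using (hR.pair_mem_nonedges (e.injective.ne (Fin.ne_of_gt hlt))).mpr h
  · rintro ⟨a, b⟩ hp ⟨c, d⟩ hq heq
    simp only [Finset.coe_filter, Finset.mem_product, Finset.mem_range, Set.mem_ofPred_eq] at hp hq
    obtain ⟨⟨ha, hb⟩, -, hlt⟩ := hp
    obtain ⟨⟨hc, hd⟩, -, hlt'⟩ := hq
    lift a to Fin 9 using ha
    lift b to Fin 9 using hb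
    lift c to Fin 9 using hc
    lift d to Fin 9 using hd
    have heq : ({e a, e b} : Set (Fin 9)) = {e c, e d} := by
      simpa using congrArg (fun s : Finset (Fin 9) => (s : Set (Fin 9))) heq
    rw [Set.pair_eq_pair_iff, e.apply_eq_iff_eq, e.apply_eq_iff_eq, e.apply_eq_iff_eq,
      e.apply_eq_iff_eq] at heq
    rcases heq with ⟨rfl, rfl⟩ | ⟨rfl, rfl⟩
    · rfl
    · omega

/-- An oriented triangulated surface with nine vertices has at least four nonedges. -/
theorem three_lt_card_nonedges (hR : S.IsOrientation R) : 3 < S.nonedges.card := by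
  by_contra! hcard
  have hdeg : ∀ v, 5 ≤ degree R v := fun v => by
    have := hR.le_degree_add_card_nonedges v
    omega
  obtain ⟨v, w, hvw, hv, hw⟩ := hR.exists_pair_full (by omega)
  obtain ⟨e, rfl, he, hloop⟩ := hR.exists_labelling (n := 8) hvw hv
  have h7 : e 7 = w := (he 7).trans hloop
  exact ((RotationSearch.three_lt_card_nonedges (hR.isComplete_table (h7 ▸ hw) hdeg)
    (hR.table_startEntries hv he hloop)).trans_le (hR.card_table_eq_ten_le e)).not_ge hcard

end TriSurface.IsOrientation

/-- Every orientable triangulated surface of Euler characteristic -2 (genus 2) has at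
least 10 vertices, even though the Heawood bound only requires
`⌈(7 + √(49 - 24 · (-2))) / 2⌉ = 9` vertices. -/
theorem genus_two_needs_ten_vertices :
    (∀ (n : ℕ) (S : TriSurface n), S.Orientable → S.eulerChar = -2 → 10 ≤ n) ∧
    ⌈(7 + Real.sqrt (49 - 24 * (-2 : ℝ))) / 2⌉ = 9 := by
  constructor
  · intro n S hS hχ
    have hedges := S.card_edges_of_eulerChar hχ
    have hcount := S.card_nonedges_add
    by_contra! hn
    rw [hedges] at hcount
    have hnine : ∀ n k : ℕ, n < 10 → k + 3 * (n + 2) = n.choose 2 → n = 9 := by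
      intro n k hn h
      rw [Nat.choose_two_right] at h
      interval_cases n <;> omega
    obtain rfl := hnine n _ hn hcount
    obtain ⟨R, hR⟩ := hS.exists_isOrientation
    have := hR.three_lt_card_nonedges
    rw [show Nat.choose 9 2 = 36 by decide] at hcount
    omega
  · have hlt : 9 < √(97 : ℝ) := Real.lt_sqrt_of_sq_lt (by norm_num)
    have hle : √(97 : ℝ) ≤ 11 := Real.sqrt_le_iff.mpr (by norm_num)
    rw [show 49 - 24 * (-2 : ℝ) = 97 by norm_num, Int.ceil_eq_iff]
    push_cast
    constructor <;> linarith
end
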